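/- There exists a Steiner system S(2,8,225); that is, there exists a finite type V with exactly 225 elements together with a family ℬ of 8-element subsets of V (blocks) such that every 2-element subset of V is contained in exactly one block of ℬ. -/

import Mathlib

/-- The base blocks `b c` develop under the translations of `A` into blocks on `I × A`: if every
mixed difference `(i, j, d)` with `(i, d) ≠ (j, 0)` occurs in some base block, and the base blocks
have no more differences than that, then every pair lies in exactly one block. -/
theorem exists_steiner_of_differences {I A κ : Type} [Fintype I] [Fintype A] [Fintype κ]
    [DecidableEq I] [DecidableEq A] [AddCommGroup A] {k : ℕ}
    (b : κ → Fin k → I × A)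
    (hcard : Fintype.card κ * (k * k - k) + Fintype.card I =
      Fintype.card I * (Fintype.card I * Fintype.card A))
    (hdiff : ∀ i j d, (i = j → d ≠ 0) →
      ∃ c x y, (b c x).1 = i ∧ (b c y).1 = j ∧ (b c y).2 - (b c x).2 = d) :
    ∃ ℬ : Finset (Finset (I × A)), (∀ B ∈ ℬ, B.card = k) ∧
      ∀ p : Finset (I × A), p.card = 2 → ∃! B, B ∈ ℬ ∧ p ⊆ B := by
  let Δ : κ × Fin k × Fin k → I × I × A :=
    fun t ↦ ((b t.1 t.2.1).1, (b t.1 t.2.2).1, (b t.1 t.2.2).2 - (b t.1 t.2.1).2)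
  let S : Finset (κ × Fin k × Fin k) := Finset.univ ×ˢ (Finset.univ : Finset (Fin k)).offDiag
  let D : Finset (I × I × A) := Finset.univ.image fun i : I ↦ (i, i, (0 : A))
  have mem_S : ∀ c x y, (c, x, y) ∈ S ↔ x ≠ y := by simp [S]
  have mem_D : ∀ i j d, (i, j, d) ∈ D ↔ i = j ∧ d = 0 := by
    intro i j d
    simp only [D, Finset.mem_image, Finset.mem_univ, true_and, Prod.mk.injEq]
    constructor
    · rintro ⟨a, rfl, rfl, rfl⟩
      exact ⟨rfl, rfl⟩
    · rintro ⟨rfl, rfl⟩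
      exact ⟨i, rfl, rfl, rfl⟩
  have card_S : S.card = Fintype.card κ * (k * k - k) := by
    simp [S, Finset.card_product, Finset.offDiag_card]
  have card_D : D.card = Fintype.card I := by
    rw [Finset.card_image_of_injective _ fun i j h ↦ congrArg Prod.fst h, Finset.card_univ]
  have card_compl : Dᶜ.card = S.card := by
    rw [Finset.card_compl, card_D, card_S, Fintype.card_prod, Fintype.card_prod, ← hcard]
    omega
  have hsub : Dᶜ ⊆ S.image Δ := by
    rintro ⟨i, j, d⟩ h
    rw [Finset.mem_compl, mem_D, not_and] at h
    obtain ⟨c, x, y, rfl, rfl, rfl⟩ := hdiff i j d h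
    refine Finset.mem_image.2 ⟨(c, x, y), (mem_S _ _ _).2 ?_, rfl⟩
    rintro rfl
    exact h rfl (sub_self _)
  have himage : Dᶜ = S.image Δ :=
    Finset.eq_of_subset_of_card_le hsub (Finset.card_image_le.trans_eq card_compl.symm)
  have hinj : Set.InjOn Δ S := Finset.injOn_of_card_image_eq (by rw [← himage, card_compl])
  have b_inj : ∀ c, Function.Injective (b c) := by
    intro c x y h
    by_contra hne
    have h1 : Δ (c, x, y) ∈ Dᶜ :=
      himage ▸ Finset.mem_image_of_mem Δ ((mem_S c x y).2 hne)
    exact Finset.mem_compl.1 h1 ((mem_D _ _ _).2 ⟨by rw [h], by simp [h]⟩)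
  let blk : κ × A → Finset (I × A) := fun t ↦
    Finset.univ.image fun x ↦ ((b t.1 x).1, (b t.1 x).2 + t.2)
  have mem_blk : ∀ c a p, p ∈ blk (c, a) ↔ ∃ x, (b c x).1 = p.1 ∧ p.2 - (b c x).2 = a := by
    rintro c a ⟨i, v⟩
    simp only [blk, Finset.mem_image, Finset.mem_univ, true_and, Prod.mk.injEq,
      sub_eq_iff_eq_add', eq_comm (a := v)]
  refine ⟨Finset.univ.image blk, ?_, ?_⟩
  · intro B hB
    obtain ⟨⟨c, a⟩, -, rfl⟩ := Finset.mem_image.1 hB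
    rw [Finset.card_image_of_injective, Finset.card_univ, Fintype.card_fin]
    intro x y h
    rw [Prod.mk.injEq, add_left_inj] at h
    exact b_inj c (Prod.ext h.1 h.2)
  · intro p hp
    obtain ⟨u, v, huv, rfl⟩ := Finset.card_eq_two.1 hp
    obtain ⟨c, x, y, hx, hy, hd⟩ := hdiff u.1 v.1 (v.2 - u.2)
      fun h h' ↦ huv (Prod.ext h (sub_eq_zero.1 h').symm)
    have hsubset : ∀ B : Finset (I × A), {u, v} ⊆ B ↔ u ∈ B ∧ v ∈ B := by
      simp [Finset.insert_subset_iff]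
    refine ⟨blk (c, u.2 - (b c x).2), ⟨Finset.mem_image_of_mem _ (Finset.mem_univ _), ?_⟩, ?_⟩
    · rw [hsubset, mem_blk, mem_blk]
      exact ⟨⟨x, hx, rfl⟩, y, hy, by rw [sub_eq_sub_iff_sub_eq_sub, hd]⟩
    · rintro B ⟨hB, huvB⟩
      obtain ⟨⟨c', a'⟩, -, rfl⟩ := Finset.mem_image.1 hB
      rw [hsubset, mem_blk, mem_blk] at huvB
      obtain ⟨⟨x', hx', rfl⟩, y', hy', ha'⟩ := huvB
      have hd' : (b c' y').2 - (b c' x').2 = v.2 - u.2 :=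
        (sub_eq_sub_iff_sub_eq_sub.1 ha').symm
      have hne : ∀ (c : κ) (x y : Fin k), (b c x).1 = u.1 → (b c y).1 = v.1 →
          (b c y).2 - (b c x).2 = v.2 - u.2 → x ≠ y := by
        rintro c x _ h1 h2 h3 rfl
        rw [sub_self] at h3
        exact huv (Prod.ext (h1.symm.trans h2) (sub_eq_zero.1 h3.symm).symm)
      have heq : (c', x', y') = (c, x, y) :=
        hinj ((mem_S _ _ _).2 (hne _ _ _ hx' hy' hd')) ((mem_S _ _ _).2 (hne _ _ _ hx hy hd))
          (by simp only [Δ, hx, hy, hd, hx', hy', hd'])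
      simp only [Prod.mk.injEq] at heq
      obtain ⟨rfl, rfl, rfl⟩ := heq
      rfl

/-- The point of `Fin 9 × ZMod 5 × ZMod 5` with number `25 * i + 5 * x + y`. -/
def pointOfNat (n : ℕ) : Fin 9 × ZMod 5 × ZMod 5 :=
  (Fin.ofNat 9 (n / 25), (Fin.ofNat 5 (n / 5) : Fin 5), (Fin.ofNat 5 n : Fin 5))

/-- Base blocks of a Steiner system `S(2,8,225)` on `Fin 9 × ZMod 5 × ZMod 5`, invariant under
`ZMod 5 × ZMod 5`; points are numbered as in `pointOfNat`. -/
def baseBlocks : Fin 36 → Fin 8 → ℕ := ![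
  ![0, 1, 61, 65, 103, 128, 189, 192],
  ![0, 2, 76, 108, 124, 126, 207, 220],
  ![0, 5, 87, 98, 140, 152, 158, 215],
  ![0, 6, 68, 78, 83, 160, 171, 218],
  ![0, 7, 66, 91, 136, 146, 187, 195],
  ![0, 8, 27, 31, 119, 141, 142, 169],
  ![0, 9, 40, 44, 53, 56, 92, 217],
  ![0, 10, 30, 155, 194, 196, 201, 214],
  ![0, 11, 58, 90, 96, 133, 168, 173],
  ![0, 12, 54, 63, 105, 107, 156, 181],
  ![0, 13, 34, 104, 114, 143, 145, 209],
  ![0, 14, 26, 38, 57, 182, 206, 208],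
  ![0, 25, 81, 99, 132, 148, 176, 179],
  ![0, 32, 48, 50, 131, 149, 151, 154],
  ![0, 33, 47, 75, 112, 118, 185, 190],
  ![0, 37, 43, 110, 115, 150, 183, 197],
  ![0, 39, 41, 59, 71, 80, 95, 100],
  ![0, 55, 70, 109, 121, 164, 166, 200],
  ![0, 86, 94, 113, 117, 175, 202, 203],
  ![0, 125, 163, 167, 177, 178, 211, 219],
  ![25, 27, 76, 101, 157, 170, 208, 224],
  ![25, 30, 90, 112, 123, 165, 177, 183],
  ![25, 33, 91, 92, 127, 131, 194, 219],
  ![25, 35, 69, 71, 130, 151, 164, 180],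
  ![25, 38, 93, 95, 134, 159, 204, 214],
  ![25, 50, 111, 119, 152, 153, 213, 217],
  ![25, 51, 54, 82, 98, 106, 124, 125],
  ![25, 52, 53, 75, 161, 169, 188, 192],
  ![25, 58, 72, 137, 143, 175, 210, 215],
  ![25, 60, 65, 100, 133, 147, 212, 218],
  ![50, 56, 118, 128, 133, 193, 210, 221],
  ![50, 62, 80, 82, 156, 179, 188, 206],
  ![50, 84, 96, 100, 180, 195, 214, 216],
  ![50, 88, 92, 102, 103, 136, 144, 150],
  ![75, 114, 116, 134, 146, 155, 170, 175],
  ![100, 126, 129, 157, 173, 181, 199, 200]]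

/-- The points of the base blocks. -/
def basePoint (c : Fin 36) (x : Fin 8) : Fin 9 × ZMod 5 × ZMod 5 :=
  pointOfNat (baseBlocks c x)

/-- A numbering of the mixed differences by the naturals below `2025`. -/
def differenceCode (t : Fin 9 × Fin 9 × Fin 5 × Fin 5) : ℕ :=
  (t.1.val * 9 + t.2.1.val) * 25 + t.2.2.1.val * 5 + t.2.2.2.val

theorem differenceCode_injective : Function.Injective differenceCode := by
  rintro ⟨i, j, x, y⟩ ⟨i', j', x', y'⟩ h
  simp only [differenceCode] at h
  simp only [Prod.mk.injEq, Fin.ext_iff]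
  omega

theorem differenceCode_lt (t : Fin 9 × Fin 9 × Fin 5 × Fin 5) : differenceCode t < 2025 := by
  simp only [differenceCode]
  omega

/-- The code of the difference between two points of a base block. -/
def baseDifferenceCode (c : Fin 36) (x y : Fin 8) : ℕ :=
  differenceCode ((basePoint c x).1, (basePoint c y).1, (basePoint c y).2 - (basePoint c x).2)

/-- The codes of all differences in the base blocks. -/
def baseDifferenceCodes : List ℕ :=
  (List.finRange 36).flatMap fun c ↦ (List.finRange 8).flatMap fun x ↦
    (List.finRange 8).map fun y ↦ baseDifferenceCode c x y

/-- The number whose binary digits mark the members of a list. -/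
def bitmask (l : List ℕ) : ℕ := l.foldr (fun n m ↦ m ||| 2 ^ n) 0

theorem mem_of_testBit_bitmask {l : List ℕ} {n : ℕ} (h : (bitmask l).testBit n) : n ∈ l := by
  induction l with
  | nil => simp [bitmask] at h
  | cons a l ih =>
    rw [show bitmask (a :: l) = bitmask l ||| 2 ^ a from rfl, Nat.testBit_or,
      Nat.testBit_two_pow, Bool.or_eq_true, decide_eq_true_eq] at h
    rcases h with h | rfl
    · exact List.mem_cons_of_mem _ (ih h)
    · exact List.mem_cons_self

theorem bitmask_baseDifferenceCodes : bitmask baseDifferenceCodes = 2 ^ 2025 - 1 := by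
  decide +kernel

theorem exists_basePoint_difference (i j : Fin 9) (d : ZMod 5 × ZMod 5) :
    ∃ c x y, (basePoint c x).1 = i ∧ (basePoint c y).1 = j ∧
      (basePoint c y).2 - (basePoint c x).2 = d := by
  have h : differenceCode (i, j, d) ∈ baseDifferenceCodes := by
    apply mem_of_testBit_bitmask
    rw [bitmask_baseDifferenceCodes, Nat.testBit_two_pow_sub_one]
    exact decide_eq_true (differenceCode_lt _)
  simp only [baseDifferenceCodes, List.mem_flatMap, List.mem_map, List.mem_finRange,
    true_and] at h
  obtain ⟨c, x, y, h⟩ := h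
  have h' := differenceCode_injective h
  exact ⟨c, x, y, congrArg (·.1) h', congrArg (·.2.1) h', congrArg (·.2.2) h'⟩

theorem stmt_0 :
    ∃ (V : Type) (_ : Fintype V), Fintype.card V = 225 ∧
      ∃ ℬ : Finset (Finset V), (∀ B ∈ ℬ, B.card = 8) ∧
        ∀ p : Finset V, p.card = 2 → ∃! B, B ∈ ℬ ∧ p ⊆ B := by
  refine ⟨Fin 9 × ZMod 5 × ZMod 5, inferInstance, by simp, ?_⟩
  exact exists_steiner_of_differences basePoint (by simp)
    fun i j d _ ↦ exists_basePoint_difference i j d
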